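/- arXiv:1605.08819 — 5 statements merged into one kernel-verified Lean document; each statement's English description precedes it below -/
import Mathlib

section
/- For every integer n ≥ 1 and every real number α, the following polynomial identity holds: ∑_{π ∈ S_n} α^{d(π)} (α+1)^{n−1−d(π)} = ∑_{k=1}^{n} S(n,k) · k! · α^{k−1}. (This is the paper's main theorem, stating that the number of α-colored ordered set partitions of [n], counted by the right-hand side, equals the descent-statistic sum on the left.) -/
def finLo {N : ℕ} (i : Fin (N - 1)) : Fin N := ⟨i.val, by have := i.isLt; omega⟩
def finHi {N : ℕ} (i : Fin (N - 1)) : Fin N := ⟨i.val + 1, by have := i.isLt; omega⟩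

/-- The number of descents of a permutation of `Fin N`:
`d(π) = #{i : π(i) > π(i+1)}`. -/
def descents {N : ℕ} (π : Equiv.Perm (Fin N)) : ℕ :=
  (Finset.univ.filter fun i : Fin (N - 1) => π (finHi i) < π (finLo i)).card

/-- Stirling numbers of the second kind. -/
def stirling : ℕ → ℕ → ℕ
  | 0, 0 => 1
  | 0, _ + 1 => 0
  | _ + 1, 0 => 0
  | n + 1, k + 1 => (k + 1) * stirling n (k + 1) + stirling n k

open Polynomial

/-- The number of descents among the first `m` consecutive pairs of a sequence. -/
def seqDescents (w : ℕ → ℕ) (m : ℕ) : ℕ :=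
  ∑ i ∈ Finset.range m, if w (i + 1) < w i then 1 else 0

/-- Insert the value `M` at position `j` of a sequence. -/
def seqInsert (w : ℕ → ℕ) (j M : ℕ) (i : ℕ) : ℕ :=
  if i < j then w i else if i = j then M else w (i - 1)

theorem seqDescents_succ (w : ℕ → ℕ) (m : ℕ) :
    seqDescents w (m + 1) = seqDescents w m + if w (m + 1) < w m then 1 else 0 :=
  Finset.sum_range_succ _ _

theorem seqDescents_congr {w w' : ℕ → ℕ} {m : ℕ} (h : ∀ i ≤ m, w i = w' i) :
    seqDescents w m = seqDescents w' m := by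
  refine Finset.sum_congr rfl fun i hi => ?_
  rw [Finset.mem_range] at hi
  rw [h i hi.le, h (i + 1) hi]

theorem seqDescents_seqInsert_zero (w : ℕ → ℕ) (M : ℕ) (h : w 0 < M) (t : ℕ) :
    seqDescents (seqInsert w 0 M) (t + 1) = seqDescents w t + 1 := by
  induction t with
  | zero => simp [seqDescents, seqInsert, Finset.filter_singleton, h]
  | succ t ih =>
    rw [seqDescents_succ, ih, seqDescents_succ]
    simp [seqInsert]
    omega

theorem seqDescents_seqInsert_end (w : ℕ → ℕ) (j M : ℕ) (h : w j ≤ M) :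
    seqDescents (seqInsert w (j + 1) M) (j + 1) = seqDescents w j := by
  rw [seqDescents_succ,
    seqDescents_congr (w' := w) fun i hi => by simp [seqInsert, Nat.lt_succ_of_le hi]]
  simp [seqInsert, h]

theorem seqDescents_seqInsert_succ (w : ℕ → ℕ) (j M : ℕ) (h : w j ≤ M) (h' : w (j + 1) < M)
    (t : ℕ) :
    seqDescents (seqInsert w (j + 1) M) (j + 1 + t + 1) =
      seqDescents w (j + 1 + t) + if w (j + 1) < w j then 0 else 1 := by
  induction t with
  | zero =>
    rw [Nat.add_zero, seqDescents_succ, seqDescents_seqInsert_end w j M h, seqDescents_succ]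
    simp only [seqInsert]
    split_ifs <;> simp_all
  | succ t ih =>
    rw [← Nat.add_assoc, seqDescents_succ, ih, seqDescents_succ]
    have h1 : seqInsert w (j + 1) M (j + 1 + t + 1 + 1) = w (j + 1 + t + 1) := by
      rw [seqInsert, if_neg (by omega), if_neg (by omega), Nat.add_sub_cancel]
    have h2 : seqInsert w (j + 1) M (j + 1 + t + 1) = w (j + 1 + t) := by
      rw [seqInsert, if_neg (by omega), if_neg (by omega), Nat.add_sub_cancel]
    rw [h1, h2]
    omega

/-- The one-line notation of a permutation of `Fin n`, extended by zero. -/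
def permSeq {n : ℕ} (π : Equiv.Perm (Fin n)) (i : ℕ) : ℕ :=
  if h : i < n then π ⟨i, h⟩ else 0

theorem permSeq_of_lt {n : ℕ} (π : Equiv.Perm (Fin n)) {i : ℕ} (h : i < n) :
    permSeq π i = π ⟨i, h⟩ := dif_pos h

theorem permSeq_lt {n : ℕ} (π : Equiv.Perm (Fin (n + 1))) (i : ℕ) : permSeq π i < n + 1 := by
  unfold permSeq
  split_ifs
  · exact (π _).isLt
  · exact n.succ_pos

theorem descents_eq_seqDescents {m : ℕ} (π : Equiv.Perm (Fin (m + 1))) :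
    descents π = seqDescents (permSeq π) m := by
  rw [descents, Finset.card_filter, seqDescents, Finset.sum_range]
  refine Finset.sum_congr rfl fun i _ => ?_
  have hi : (i : ℕ) < m := i.isLt
  rw [permSeq_of_lt π (Nat.succ_lt_succ hi), permSeq_of_lt π (hi.trans m.lt_succ_self)]
  rfl

theorem descents_le {m : ℕ} (π : Equiv.Perm (Fin (m + 1))) : descents π ≤ m :=
  (Finset.card_le_univ _).trans_eq (Fintype.card_fin m)

/-- Insert a new maximum at position `j` of the one-line notation of `π`. -/
def insertMax {n : ℕ} (j : Fin (n + 1)) (π : Equiv.Perm (Fin n)) : Equiv.Perm (Fin (n + 1)) :=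
  (finSuccEquiv' j).trans (π.optionCongr.trans (finSuccEquiv' (Fin.last n)).symm)

theorem insertMax_self {n : ℕ} (j : Fin (n + 1)) (π : Equiv.Perm (Fin n)) :
    insertMax j π j = Fin.last n := by
  simp [insertMax]

theorem insertMax_succAbove {n : ℕ} (j : Fin (n + 1)) (π : Equiv.Perm (Fin n)) (i : Fin n) :
    insertMax j π (j.succAbove i) = (π i).castSucc := by
  simp [insertMax]

theorem insertMax_bijective (n : ℕ) :
    Function.Bijective fun p : Fin (n + 1) × Equiv.Perm (Fin n) => insertMax p.1 p.2 := by
  rw [Fintype.bijective_iff_injective_and_card]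
  refine ⟨?_, by simp [Fintype.card_perm, Nat.factorial_succ]⟩
  rintro ⟨j, π⟩ ⟨k, σ⟩ h
  have hjk : j = k := (insertMax k σ).injective <| by
    rw [insertMax_self, ← insertMax_self j π]
    exact (DFunLike.congr_fun h j).symm
  subst hjk
  have hπ : π = σ := Equiv.ext fun i => Fin.castSucc_injective n <| by
    rw [← insertMax_succAbove j, ← insertMax_succAbove j]
    exact DFunLike.congr_fun h _
  rw [hπ]

theorem permSeq_insertMax {n : ℕ} (j : Fin (n + 1)) (π : Equiv.Perm (Fin n)) {i : ℕ}
    (hi : i < n + 1) : permSeq (insertMax j π) i = seqInsert (permSeq π) j n i := by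
  rw [permSeq_of_lt _ hi]
  obtain h | ⟨k, h⟩ := Fin.eq_self_or_eq_succAbove j ⟨i, hi⟩
  · have hij : i = j := congrArg Fin.val h
    rw [h, insertMax_self]
    simp [seqInsert, hij]
  · have hik : i = (j.succAbove k : ℕ) := congrArg Fin.val h
    rw [h, insertMax_succAbove, Fin.val_castSucc, hik, seqInsert]
    rcases lt_or_ge (k.castSucc) j with hkj | hkj
    · rw [Fin.succAbove_of_castSucc_lt _ _ hkj, if_pos (by exact hkj), Fin.val_castSucc, permSeq_of_lt _ k.isLt]
    · have hkj' : (j : ℕ) ≤ k := hkj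
      rw [Fin.succAbove_of_le_castSucc _ _ hkj, if_neg (by simp; omega),
        if_neg (by simp; omega), permSeq_of_lt _ (by simp)]
      simp

theorem descents_insertMax {m : ℕ} (j : Fin (m + 2)) (π : Equiv.Perm (Fin (m + 1))) :
    descents (insertMax j π) = seqDescents (seqInsert (permSeq π) j (m + 1)) (m + 1) := by
  rw [descents_eq_seqDescents]
  exact seqDescents_congr fun i hi => permSeq_insertMax j π (Nat.lt_succ_of_le hi)

theorem sum_descents_insertMax {R : Type*} [CommRing R] (f : ℕ → R) {m : ℕ}
    (π : Equiv.Perm (Fin (m + 1))) :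
    ∑ j, f (descents (insertMax j π)) =
      (descents π + 1) * f (descents π) + (m + 1 - descents π) * f (descents π + 1) := by
  have hlt := permSeq_lt π
  have hmid : ∀ j ∈ Finset.range m,
      f (seqDescents (seqInsert (permSeq π) (j + 1) (m + 1)) (m + 1)) =
        f (descents π + 1) + (if permSeq π (j + 1) < permSeq π j then 1 else 0) *
          (f (descents π) - f (descents π + 1)) := by
    intro j hj
    obtain ⟨t, rfl⟩ := Nat.exists_eq_add_of_le (Nat.succ_le_of_lt (Finset.mem_range.1 hj))
    rw [seqDescents_seqInsert_succ _ _ _ (hlt j).le (hlt (j + 1)), descents_eq_seqDescents]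
    split_ifs <;> simp
  have hd : ∑ j ∈ Finset.range m, (if permSeq π (j + 1) < permSeq π j then (1 : R) else 0) =
      descents π := by
    rw [descents_eq_seqDescents, seqDescents]
    push_cast
    rfl
  simp only [descents_insertMax]
  rw [← Finset.sum_range
      fun j => f (seqDescents (seqInsert (permSeq π) j (m + 1)) (m + 1)),
    Finset.sum_range_succ, Finset.sum_range_succ', Finset.sum_congr rfl hmid,
    seqDescents_seqInsert_end _ _ _ (hlt m).le, seqDescents_seqInsert_zero _ _ (hlt 0),
    Finset.sum_add_distrib, ← Finset.sum_mul, hd, ← descents_eq_seqDescents]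
  simp
  ring

theorem sum_perm_succ_descents {R : Type*} [CommRing R] (f : ℕ → R) (m : ℕ) :
    ∑ π : Equiv.Perm (Fin (m + 2)), f (descents π) =
      ∑ π : Equiv.Perm (Fin (m + 1)),
        ((descents π + 1) * f (descents π) + (m + 1 - descents π) * f (descents π + 1)) := by
  rw [← (insertMax_bijective (m + 1)).sum_comp, Fintype.sum_prod_type_right]
  exact Finset.sum_congr rfl fun π _ => sum_descents_insertMax f π

theorem derivative_mul_descent_monomial {R : Type*} [CommRing R] {m d : ℕ} (h : d ≤ m) :
    derivative (X * (X + 1) * (X ^ d * (X + 1) ^ (m - d)) : R[X]) =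
      ((d : R[X]) + 1) * (X ^ d * (X + 1) ^ (m + 1 - d)) +
        ((m : R[X]) + 1 - (d : R[X])) * (X ^ (d + 1) * (X + 1) ^ (m + 1 - (d + 1))) := by
  obtain ⟨e, rfl⟩ := Nat.exists_eq_add_of_le h
  rw [show d + e - d = e by omega, show d + e + 1 - d = e + 1 by omega,
    show d + e + 1 - (d + 1) = e by omega,
    show (X * (X + 1) * (X ^ d * (X + 1) ^ e) : R[X]) = X ^ (d + 1) * (X + 1) ^ (e + 1) by ring]
  simp [derivative_mul, derivative_pow]
  ring

theorem stirling_eq_zero_of_lt : ∀ {n k : ℕ}, n < k → stirling n k = 0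
  | 0, _ + 1, _ => rfl
  | n + 1, k + 1, h => by
    rw [stirling, stirling_eq_zero_of_lt (by omega : n < k + 1),
      stirling_eq_zero_of_lt (by omega : n < k), mul_zero]

theorem sum_stirling_succ (R : Type*) [CommRing R] (m : ℕ) :
    ∑ k ∈ Finset.range (m + 2),
        ((stirling (m + 2) (k + 1) * (k + 1).factorial : ℕ) : R[X]) * X ^ k =
      derivative (X * (X + 1) * ∑ k ∈ Finset.range (m + 1),
        ((stirling (m + 1) (k + 1) * (k + 1).factorial : ℕ) : R[X]) * X ^ k) := by
  have hder : ∀ k : ℕ,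
      derivative (X * (X + 1) *
        (((stirling (m + 1) (k + 1) * (k + 1).factorial : ℕ) : R[X]) * X ^ k)) =
      ((stirling (m + 1) (k + 1) * (k + 2).factorial : ℕ) : R[X]) * X ^ (k + 1) +
      ((stirling (m + 1) (k + 1) * (k + 1) * (k + 1).factorial : ℕ) : R[X]) * X ^ k := by
    intro k
    rw [show (X * (X + 1) *
        (((stirling (m + 1) (k + 1) * (k + 1).factorial : ℕ) : R[X]) * X ^ k)) =
        ((stirling (m + 1) (k + 1) * (k + 1).factorial : ℕ) : R[X]) *
          (X ^ (k + 2) + X ^ (k + 1)) by ring, derivative_natCast_mul,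
      Nat.factorial_succ (k + 1)]
    simp
    ring
  rw [Finset.mul_sum, derivative_sum, Finset.sum_congr rfl fun k _ => hder k,
    Finset.sum_add_distrib]
  have hsplit : ∀ k : ℕ,
      ((stirling (m + 2) (k + 1) * (k + 1).factorial : ℕ) : R[X]) * X ^ k =
      ((stirling (m + 1) k * (k + 1).factorial : ℕ) : R[X]) * X ^ k +
      ((stirling (m + 1) (k + 1) * (k + 1) * (k + 1).factorial : ℕ) : R[X]) * X ^ k := by
    intro k
    rw [stirling]
    push_cast
    ring
  rw [Finset.sum_congr rfl fun k _ => hsplit k, Finset.sum_add_distrib,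
    Finset.sum_range_succ', Finset.sum_range_succ _ (m + 1),
    stirling_eq_zero_of_lt (by omega : m + 1 < m + 1 + 1)]
  simp [stirling]

theorem sum_descents_eq_sum_stirling (R : Type*) [CommRing R] (m : ℕ) :
    ∑ π : Equiv.Perm (Fin (m + 1)), (X ^ descents π * (X + 1) ^ (m - descents π) : R[X]) =
      ∑ k ∈ Finset.range (m + 1),
        ((stirling (m + 1) (k + 1) * (k + 1).factorial : ℕ) : R[X]) * X ^ k := by
  induction m with
  | zero => simp [descents, stirling]
  | succ m ih =>
    rw [sum_stirling_succ, ← ih, Finset.mul_sum, derivative_sum,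
      sum_perm_succ_descents fun d => (X ^ d * (X + 1) ^ (m + 1 - d) : R[X])]
    exact Finset.sum_congr rfl fun π _ => (derivative_mul_descent_monomial (descents_le π)).symm

/-- Theorem (main theorem): for `n ≥ 1` and any real `α`,
`∑_{π ∈ S_n} α^{d(π)} (α+1)^{n−1−d(π)} = ∑_{k=1}^{n} S(n,k)·k!·α^{k−1}`. -/
theorem stmt0 (n : ℕ) (hn : 1 ≤ n) (α : ℝ) :
    ∑ π : Equiv.Perm (Fin n), α ^ descents π * (α + 1) ^ (n - 1 - descents π)
      = ∑ k ∈ Finset.Icc 1 n,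
          (stirling n k * Nat.factorial k : ℝ) * α ^ (k - 1) := by
  obtain ⟨m, rfl⟩ := Nat.exists_eq_add_of_le' hn
  have h := congrArg (eval α) (sum_descents_eq_sum_stirling ℝ m)
  simp only [eval_finsetSum, eval_mul, eval_pow, eval_add, eval_X, eval_one, eval_natCast] at h
  rw [← Finset.Ico_add_one_right_eq_Icc, Finset.sum_Ico_eq_sum_range]
  refine h.trans (Finset.sum_congr rfl fun k _ => ?_)
  rw [add_comm 1 k]
  push_cast
  rfl
end

section
/- For every integer n ≥ 1 and every real number α, ∑_{c ∈ Comp(n)} (α−1)^{ℓ(c)−1} · binom(n; c) = ∑_{π ∈ S_n} α^{d(π)} (α−1)^{n−1−d(π)}, where the left-hand sum is over all compositions c of n. (Both sides count the facets, i.e., the connected components, of the α-colored permutohedron P_n^α.) -/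
/-- The multinomial coefficient `binom(n; c) = n!/(c_1!·c_2!·⋯·c_ℓ!)`
associated to a composition `c` of `n` (the division is exact). -/
def compMultinomial {n : ℕ} (c : Composition n) : ℕ :=
  Nat.factorial n / (c.blocks.map Nat.factorial).prod

/-- The permutations `π` that are decreasing on every fibre of a monotone `f` form a transversal
for the right cosets of the group of permutations preserving `f`. -/
theorem card_decreasing_on_fibres_mul_card_stabilizer {n : ℕ} {β : Type*} [LinearOrder β]
    {f : Fin n → β} (hf : Monotone f) :
    Fintype.card {π : Equiv.Perm (Fin n) // ∀ i j, i < j → f i = f j → π j < π i} *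
      Fintype.card {g : Equiv.Perm (Fin n) // f ∘ g = f} = n.factorial := by
  have hn : Fintype.card (Equiv.Perm (Fin n)) = n.factorial := by
    rw [Fintype.card_perm, Fintype.card_fin]
  rw [← Fintype.card_prod, ← hn]
  refine Fintype.card_of_bijective (f := fun p => p.1.1 * p.2.1) ⟨?_, fun π => ?_⟩
  · rintro ⟨⟨π, hπ⟩, ⟨g, hg⟩⟩ ⟨⟨π', hπ'⟩, ⟨g', hg'⟩⟩ h
    have h : π * g = π' * g' := h
    have hg (x) : f (g x) = f x := congrFun hg x
    have hg' (x) : f (g' x) = f x := congrFun hg' x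
    have hk (x) : f ((g' * g⁻¹) x) = f x := by
      rw [Equiv.Perm.mul_apply, hg', ← hg, ← Equiv.Perm.mul_apply, mul_inv_cancel,
        Equiv.Perm.one_apply]
    have hπk : π = π' * (g' * g⁻¹) := by rw [← mul_assoc, ← h]; group
    have hmono : StrictMono (g' * g⁻¹ : Equiv.Perm (Fin n)) := by
      intro i j hij
      rcases (hf hij.le).eq_or_lt with e | e
      · have h1 := hπ i j hij e
        rw [hπk] at h1
        by_contra! h2
        rcases h2.eq_or_lt with h3 | h3
        · exact hij.ne' ((g' * g⁻¹).injective h3)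
        · exact lt_asymm h1 (hπ' _ _ h3 (by rw [hk, hk, e]))
      · rw [← hk i, ← hk j] at e
        exact hf.reflect_lt e
    have hone : g' * g⁻¹ = 1 := by
      ext1 x
      exact DFunLike.congr_fun (Subsingleton.elim
        (hmono.orderIsoOfSurjective _ (Equiv.surjective _)) (OrderIso.refl _)) x
    obtain rfl : g' = g := mul_inv_eq_one.1 hone
    obtain rfl : π = π' := mul_right_cancel h
    rfl
  · let key : Fin n → β ×ₗ (Fin n)ᵒᵈ := fun i => toLex (f i, OrderDual.toDual (π i))
    have hs := Tuple.monotone_sort key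
    set s := Tuple.sort key
    have hfs : f ∘ s = f := by
      refine Tuple.unique_monotone (f := f) (σ := s) (τ := 1) (fun i j hij => ?_) hf
      rcases Prod.Lex.toLex_le_toLex.1 (hs hij) with h | h
      exacts [h.le, h.1.le]
    refine ⟨⟨⟨π * s, fun i j hij e => ?_⟩, ⟨s⁻¹, ?_⟩⟩, by simp⟩
    · have e' : f (s i) = f (s j) := by
        rw [← Function.comp_apply (f := f), hfs, e, ← Function.comp_apply (f := f) (g := s), hfs]
      rcases Prod.Lex.toLex_le_toLex.1 (hs hij.le) with h | h
      · exact absurd e' h.ne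
      · exact lt_of_le_of_ne (OrderDual.toDual_le_toDual.1 h.2) fun h' =>
          hij.ne' ((π * s).injective h')
    · funext x
      conv_lhs => rw [← hfs]
      simp

namespace Composition

variable {n : ℕ} (c : Composition n)

theorem monotone_index : Monotone c.index := by
  intro i j hij
  by_contra! h
  have h1 := c.monotone_sizeUpTo (Nat.succ_le_of_lt (Fin.lt_def.1 h))
  have h2 := c.sizeUpTo_index_le i
  have h3 := c.lt_sizeUpTo_index_succ j
  simp only [Fin.val_succ, Nat.succ_eq_add_one] at h1 h3
  have := Fin.le_def.1 hij
  omega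

theorem card_index_fibre (i : Fin c.length) :
    Fintype.card {a // c.index a = i} = c.blocksFun i := by
  rw [← Fintype.card_fin (c.blocksFun i)]
  refine Fintype.card_congr (Equiv.ofBijective (fun j => ⟨c.embedding i j, c.index_embedding i j⟩)
    ⟨fun j k h => ?_, ?_⟩).symm
  · exact (c.embedding i).injective (Subtype.ext_iff.1 h)
  · rintro ⟨a, rfl⟩
    exact ⟨c.invEmbedding a, Subtype.ext (c.embedding_comp_inv a)⟩

theorem card_decreasing_on_blocks :
    Fintype.card {π : Equiv.Perm (Fin n) // ∀ i j, i < j → c.index i = c.index j → π j < π i} =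
      compMultinomial c := by
  have h := card_decreasing_on_fibres_mul_card_stabilizer c.monotone_index
  have hprod : (c.blocks.map Nat.factorial).prod =
      Fintype.card {g : Equiv.Perm (Fin n) // c.index ∘ g = c.index} := by
    rw [DomMulAct.stabilizer_card]
    simp_rw [card_index_fibre]
    rw [← c.ofFn_blocksFun, List.map_ofFn, List.prod_ofFn]
    rfl
  rw [compMultinomial, hprod, ← h, Nat.mul_div_cancel _ (Fintype.card_pos_iff.2 ⟨1, rfl⟩)]

theorem mem_boundaries_iff (i : Fin (n - 1)) :
    (⟨1 + (i : ℕ), by omega⟩ : Fin n.succ) ∈ c.boundaries ↔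
      c.index (finLo i) ≠ c.index (finHi i) := by
  have h1 := c.sizeUpTo_index_le (finLo i)
  have h2 := c.lt_sizeUpTo_index_succ (finLo i)
  have h3 := c.sizeUpTo_index_le (finHi i)
  have h4 := c.lt_sizeUpTo_index_succ (finHi i)
  have hle : c.index (finLo i) ≤ c.index (finHi i) :=
    c.monotone_index (Fin.le_def.2 (Nat.le_succ _))
  simp only [finLo, finHi, Fin.val_succ] at h1 h2 h3 h4 hle ⊢
  simp only [boundaries, Finset.mem_map, Finset.mem_univ, true_and]
  constructor
  · rintro ⟨k, hk⟩ e
    have hk : c.sizeUpTo k = 1 + (i : ℕ) := congrArg Fin.val hk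
    rw [← e] at h4
    rcases Nat.lt_or_ge (c.index ⟨i, by omega⟩ : ℕ) k with h | h
    · have := c.monotone_sizeUpTo (Nat.succ_le_of_lt h)
      simp only [Nat.succ_eq_add_one] at this
      omega
    · have := c.monotone_sizeUpTo h
      omega
  · intro e
    refine ⟨(c.index ⟨i, by omega⟩).succ, Fin.ext ?_⟩
    have := c.monotone_sizeUpTo (Nat.succ_le_of_lt (Fin.lt_def.1 (lt_of_le_of_ne hle e)))
    simp only [Nat.succ_eq_add_one] at this
    change c.sizeUpTo ((c.index ⟨i, by omega⟩ : ℕ) + 1) = 1 + (i : ℕ)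
    omega

/-- The positions `i` such that `i` and `i + 1` lie in the same block. -/
def inner : Finset (Fin (n - 1)) :=
  Finset.univ.filter fun i => c.index (finLo i) = c.index (finHi i)

theorem compl_inner :
    c.innerᶜ = compositionAsSetEquiv n (compositionEquiv n c) := by
  ext i
  have := c.mem_boundaries_iff i
  simp only [inner, Finset.mem_compl, Finset.mem_filter, Finset.mem_univ, true_and]
  refine this.symm.trans ?_
  simp [compositionAsSetEquiv, compositionEquiv, toCompositionAsSet]

theorem bijective_inner (n : ℕ) : Function.Bijective (inner (n := n)) := by
  have h : (fun c : Composition n => c.innerᶜ) =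
      (compositionEquiv n).trans (compositionAsSetEquiv n) := funext compl_inner
  refine (compl_involutive.bijective.of_comp_iff' _).1 ?_
  change Function.Bijective fun c : Composition n => c.innerᶜ
  rw [h]
  exact Equiv.bijective _

theorem card_inner (hn : 1 ≤ n) : n - 1 - c.inner.card = c.length - 1 := by
  have hcompl := Finset.card_compl c.inner
  rw [Fintype.card_fin] at hcompl
  rw [← hcompl]
  have hmap : c.boundaries = insert 0 (insert (Fin.last n) (c.innerᶜ.map
      ⟨fun i : Fin (n - 1) => (⟨1 + (i : ℕ), by omega⟩ : Fin (n + 1)), fun i j h => by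
        simpa [Fin.ext_iff] using h⟩)) := by
    ext k
    simp only [Finset.mem_insert, Finset.mem_map]
    constructor
    · intro hk
      by_cases h0 : k = 0
      · exact .inl h0
      by_cases hl : k = Fin.last n
      · exact .inr (.inl hl)
      have h0' : (k : ℕ) ≠ 0 := fun h => h0 (Fin.ext h)
      have hl' : (k : ℕ) ≠ n := fun h => hl (Fin.ext h)
      have hkn := k.isLt
      have hki : (⟨1 + (k - 1 : ℕ), by omega⟩ : Fin (n + 1)) = k := Fin.ext (by simp; omega)
      refine .inr (.inr ⟨⟨k - 1, by omega⟩, ?_, hki⟩)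
      have := (c.mem_boundaries_iff ⟨k - 1, by omega⟩).1 (by simpa only [hki] using hk)
      simpa [inner] using this
    · rintro (rfl | rfl | ⟨i, hi, rfl⟩)
      · exact c.toCompositionAsSet.zero_mem
      · exact c.toCompositionAsSet.getLast_mem
      · exact (c.mem_boundaries_iff i).2 (by simpa [inner] using hi)
  have hcard := congrArg Finset.card hmap
  rw [card_boundaries_eq_succ_length, Finset.card_insert_of_notMem, Finset.card_insert_of_notMem,
    Finset.card_map] at hcard
  · omega
  · simp only [Finset.mem_map, not_exists, not_and]
    intro i _ h
    have : 1 + (i : ℕ) = n := congrArg Fin.val h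
    omega
  · simp only [Finset.mem_insert, Finset.mem_map, not_or, not_exists, not_and]
    refine ⟨fun h => ?_, fun i _ h => ?_⟩
    · have : 0 = n := congrArg Fin.val h
      omega
    · have : 1 + (i : ℕ) = 0 := congrArg Fin.val h
      omega

theorem decreasing_on_blocks_iff (π : Equiv.Perm (Fin n)) :
    (∀ i j, i < j → c.index i = c.index j → π j < π i) ↔
      c.inner ⊆ Finset.univ.filter fun i : Fin (n - 1) => π (finHi i) < π (finLo i) := by
  constructor
  · intro h i hi
    simp only [inner, Finset.mem_filter, Finset.mem_univ, true_and] at hi ⊢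
    exact h _ _ (Fin.lt_def.2 (Nat.lt_succ_self _)) hi
  · rintro h ⟨i, hi⟩ ⟨j, hj⟩ hij e
    replace hij : i + 1 ≤ j := hij
    have hstep (k : ℕ) (hk : k + 1 < n)
        (e : c.index ⟨k, by omega⟩ = c.index ⟨k + 1, hk⟩) : π ⟨k + 1, hk⟩ < π ⟨k, by omega⟩ := by
      exact (Finset.mem_filter.1 (@h ⟨k, by omega⟩
        (Finset.mem_filter.2 ⟨Finset.mem_univ _, e⟩))).2
    induction j, hij using Nat.le_induction with
    | base => exact hstep i hj e
    | succ j hij ih =>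
      have h1 : c.index ⟨i, hi⟩ ≤ c.index ⟨j, by omega⟩ :=
        c.monotone_index (Fin.le_def.2 (Nat.le_of_succ_le hij))
      have h2 : c.index ⟨j, by omega⟩ ≤ c.index ⟨j + 1, hj⟩ :=
        c.monotone_index (Fin.le_def.2 (Nat.le_succ j))
      have e1 : c.index ⟨i, hi⟩ = c.index ⟨j, by omega⟩ := le_antisymm h1 (e ▸ h2)
      exact (hstep j hj (e1 ▸ e)).trans (ih (by omega) e1 hstep)

end Composition

/-- For `n ≥ 1` and real `α`,
`∑_{c ∈ Comp(n)} (α−1)^{ℓ(c)−1}·binom(n; c) = ∑_{π ∈ S_n} α^{d(π)} (α−1)^{n−1−d(π)}`. -/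
theorem stmt7 (n : ℕ) (hn : 1 ≤ n) (α : ℝ) :
    ∑ c : Composition n, (α - 1) ^ (c.length - 1) * (compMultinomial c : ℝ)
      = ∑ π : Equiv.Perm (Fin n), α ^ descents π * (α - 1) ^ (n - 1 - descents π) := by
  let des (π : Equiv.Perm (Fin n)) : Finset (Fin (n - 1)) :=
    Finset.univ.filter fun i => π (finHi i) < π (finLo i)
  have expand (π : Equiv.Perm (Fin n)) : α ^ descents π * (α - 1) ^ (n - 1 - descents π) =
      ∑ c : Composition n, if c.inner ⊆ des π then (α - 1) ^ (c.length - 1) else 0 := by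
    have hd : (des π).card ≤ n - 1 := by simpa using (des π).card_le_univ
    have hα : α ^ (des π).card =
        ∑ t ∈ (des π).powerset, (α - 1) ^ ((des π).card - t.card) := by
      simpa using (Finset.sum_pow_mul_eq_add_pow (1 : ℝ) (α - 1) (des π)).symm
    calc α ^ descents π * (α - 1) ^ (n - 1 - descents π)
        = ∑ t ∈ (des π).powerset, (α - 1) ^ (n - 1 - t.card) := by
          change α ^ (des π).card * (α - 1) ^ (n - 1 - (des π).card) = _
          rw [hα, Finset.sum_mul]
          refine Finset.sum_congr rfl fun t ht => ?_
          have := Finset.card_le_card (Finset.mem_powerset.1 ht)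
          rw [← pow_add]
          congr 1
          omega
      _ = ∑ t : Finset (Fin (n - 1)), if t ⊆ des π then (α - 1) ^ (n - 1 - t.card) else 0 := by
          rw [← Finset.sum_filter]
          exact Finset.sum_congr (by ext; simp) fun _ _ => rfl
      _ = _ := by
          refine ((Composition.bijective_inner n).sum_comp fun t : Finset (Fin (n - 1)) =>
            if t ⊆ des π then (α - 1) ^ (n - 1 - t.card) else 0).symm.trans ?_
          simp only [Composition.card_inner _ hn]
  simp_rw [expand]
  rw [Finset.sum_comm]
  refine Finset.sum_congr rfl fun c _ => ?_
  rw [← Finset.sum_filter, Finset.sum_const, nsmul_eq_mul, mul_comm,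
    ← c.card_decreasing_on_blocks, Fintype.card_subtype]
  simp only [c.decreasing_on_blocks_iff, des]
end

section
/- Fix integers n ≥ 1, α ≥ 1, and a color β ∈ {1,…,α}. For every real number x, ∑_{τ ∈ S_{n,β}^α} x^{d(τ)} = ∑_{π ∈ S_n} (αx)^{d(π)} (1 + (α−1)x)^{n−1−d(π)}, where the left-hand sum is over all α-colored permutations of [n] with last color β. (That is, the descent generating polynomial of α-colored permutations with fixed last color is the α-colored Eulerian polynomial A_n^α(x).) -/
/-- The number of descents of an `A`-colored permutation `(w, c)` of `Fin N`:
positions `i` where `w(i) > w(i+1)` or `c(i) ≠ c(i+1)`. -/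
def coloredDescents {N A : ℕ} (w : Equiv.Perm (Fin N)) (c : Fin N → Fin A) : ℕ :=
  (Finset.univ.filter fun i : Fin (N - 1) =>
    w (finHi i) < w (finLo i) ∨ c (finLo i) ≠ c (finHi i)).card

/-- The `A`-colored permutations of `Fin N` with last color `β`: pairs `(w, c)`
of a permutation `w` and a coloring `c` whose last value is `β`. -/
def coloredPerms (N A : ℕ) (β : Fin A) :
    Finset (Equiv.Perm (Fin N) × (Fin N → Fin A)) :=
  Finset.univ.filter fun τ => ∀ h : N - 1 < N, τ.2 ⟨N - 1, h⟩ = β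

theorem sum_ite_or_ne {A : ℕ} (p : Prop) [Decidable p] (b : Fin A) (x : ℝ) :
    ∑ a : Fin A, (if p ∨ a ≠ b then x else 1)
      = if p then (A : ℝ) * x else 1 + ((A : ℝ) - 1) * x := by
  by_cases hp : p
  · simp [hp]
  · have h : ∀ a : Fin A, (if p ∨ a ≠ b then x else 1) = x + if a = b then 1 - x else 0 := by
      intro a
      by_cases hab : a = b <;> simp [hp, hab]
    rw [Finset.sum_congr rfl fun a _ => h a, Finset.sum_add_distrib, Finset.sum_ite_eq',
      if_pos (Finset.mem_univ b), if_neg hp, Finset.sum_const, Finset.card_univ,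
      Fintype.card_fin, nsmul_eq_mul]
    ring

/-- Summing over all colorings with prescribed last color, each position contributes
an independent factor. -/
theorem sum_colorings_prod {A : ℕ} (β : Fin A) (x : ℝ) :
    ∀ (m : ℕ) (P : Fin m → Prop) [DecidablePred P],
      ∑ c : Fin (m + 1) → Fin A, (if c (Fin.last m) = β then
          ∏ i : Fin m, (if P i ∨ c i.castSucc ≠ c i.succ then x else 1) else 0)
        = ∏ i : Fin m, (if P i then (A : ℝ) * x else 1 + ((A : ℝ) - 1) * x)
  | 0, P, _ => by
    rw [← (Equiv.funUnique (Fin 1) (Fin A)).symm.sum_comp]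
    simp
  | m + 1, P, _ => by
    rw [← (Fin.consEquiv fun _ => Fin A).sum_comp, Fintype.sum_prod_type_right,
      Fin.prod_univ_succ, ← sum_colorings_prod β x m fun i => P i.succ, Finset.mul_sum]
    refine Finset.sum_congr rfl fun c _ => ?_
    rw [← sum_ite_or_ne (P 0) (c 0) x, Finset.sum_mul]
    refine Finset.sum_congr rfl fun a _ => ?_
    simp only [Fin.consEquiv_apply, Fin.prod_univ_succ, ← Fin.succ_last, Fin.cons_succ,
      Fin.castSucc_zero, Fin.cons_zero, ← Fin.succ_castSucc, mul_ite, mul_zero]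

/-- For `n ≥ 1`, `α ≥ 1`, a color `β`, and any real `x`:
`∑_{τ ∈ S_{n,β}^α} x^{d(τ)} = ∑_{π ∈ S_n} (αx)^{d(π)} (1+(α−1)x)^{n−1−d(π)}`,
i.e. the descent generating polynomial of `α`-colored permutations with fixed
last color is the `α`-colored Eulerian polynomial `A_n^α(x)`. -/
theorem stmt10 (n A : ℕ) (hn : 1 ≤ n) (hA : 1 ≤ A) (β : Fin A) (x : ℝ) :
    ∑ τ ∈ coloredPerms n A β, x ^ coloredDescents τ.1 τ.2
      = ∑ π : Equiv.Perm (Fin n),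
          ((A : ℝ) * x) ^ descents π *
            (1 + ((A : ℝ) - 1) * x) ^ (n - 1 - descents π) := by
  obtain ⟨m, rfl⟩ : ∃ m, n = m + 1 := ⟨n - 1, by omega⟩
  rw [coloredPerms, Finset.sum_filter, Fintype.sum_prod_type]
  refine Finset.sum_congr rfl fun w _ => ?_
  have hcolor := sum_colorings_prod β x m fun i => w i.succ < w i.castSucc
  have hcard : (Finset.univ.filter fun i : Fin m => ¬ w i.succ < w i.castSucc).card
      = m - descents w := by
    have h := Finset.card_filter_add_card_filter_not (s := (Finset.univ : Finset (Fin m)))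
      fun i => w i.succ < w i.castSucc
    rw [Finset.card_univ, Fintype.card_fin] at h
    change descents w + _ = m at h
    omega
  rw [Finset.prod_ite, Finset.prod_const, Finset.prod_const, hcard] at hcolor
  refine Eq.trans (Finset.sum_congr rfl fun c _ => ?_) hcolor
  have hlast : (∀ h : m + 1 - 1 < m + 1, c ⟨m + 1 - 1, h⟩ = β) ↔ c (Fin.last m) = β :=
    ⟨fun h => h (Nat.lt_succ_self m), fun h _ => h⟩
  refine if_congr hlast ?_ rfl
  rw [Finset.prod_ite, Finset.prod_const, Finset.prod_const_one, mul_one]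
  rfl
end

section
/- Fix integers n ≥ 1, α ≥ 1, a color β ∈ {1,…,α}, and an integer m with 0 ≤ m ≤ n−1. The number of α-colored permutations of [n] with last color β having exactly m descents equals ∑_{π ∈ S_n, d(π) ≤ m} α^{d(π)} (α−1)^{m−d(π)} · C(n−1−d(π), m−d(π)), where C(a,b) denotes the binomial coefficient. -/
open Polynomial in
/-- The sum over one color `a` of the descent weight of a step to the color `b`. -/
theorem sum_color_weight {A : ℕ} (q : Prop) [Decidable q] (b : Fin A) :
    ∑ a : Fin A, (if q ∨ a ≠ b then (X : ℕ[X]) else 1)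
      = if q then C A * X else 1 + C (A - 1) * X := by
  by_cases hq : q
  · simp [hq]
  · simp only [hq, false_or, if_false, ne_eq, ite_not]
    rw [← Finset.add_sum_erase _ _ (Finset.mem_univ b), if_pos rfl,
      Finset.sum_congr rfl (fun a ha => if_neg (Finset.ne_of_mem_erase ha))]
    simp [Finset.card_erase_of_mem]

open Polynomial in
/-- The generating function of colorings with last color `β`, by the number of positions
that satisfy `p` or at which the color changes. -/
theorem sum_coloring_weight {A : ℕ} (β : Fin A) (K : ℕ) (p : Fin K → Prop) [DecidablePred p] :
    ∑ c : Fin (K + 1) → Fin A, (if c (Fin.last K) = β then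
        ∏ i : Fin K, (if p i ∨ c i.castSucc ≠ c i.succ then (X : ℕ[X]) else 1) else 0)
      = ∏ i : Fin K, (if p i then C A * X else 1 + C (A - 1) * X) := by
  induction K with
  | zero =>
    rw [← (Equiv.funUnique (Fin 1) (Fin A)).symm.sum_comp]
    simp
  | succ K ih =>
    rw [Fin.prod_univ_succ, ← ih fun i => p i.succ,
      ← (Fin.consEquiv fun _ : Fin (K + 2) => Fin A).sum_comp, Fintype.sum_prod_type_right,
      Finset.mul_sum]
    refine Finset.sum_congr rfl fun c _ => ?_
    rw [← sum_color_weight (p 0) (c 0), Finset.sum_mul]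
    refine Finset.sum_congr rfl fun a _ => ?_
    have hl : Fin.last (K + 1) = (Fin.last K).succ := rfl
    rw [Fin.prod_univ_succ]
    simp only [Fin.consEquiv_apply, hl, Fin.cons_succ, Fin.castSucc_zero, Fin.cons_zero,
      ← Fin.succ_castSucc, mul_ite, mul_zero]

open Polynomial in
theorem coeff_one_add_C_mul_X_pow (a j k : ℕ) :
    ((1 + C a * X : ℕ[X]) ^ j).coeff k = a ^ k * j.choose k := by
  have h : (1 + C a * X : ℕ[X]) ^ j = ((1 + X) ^ j).comp (C a * X) := by simp
  rw [h, comp_C_mul_X_coeff, coeff_one_add_X_pow]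
  simp [mul_comm]

open Polynomial in
/-- The number of colorings with last color `β` for which exactly `m` positions satisfy `p` or
have a color change. -/
theorem card_coloring {A : ℕ} (β : Fin A) (K m : ℕ) (p : Fin K → Prop) [DecidablePred p] :
    (Finset.univ.filter fun c : Fin (K + 1) → Fin A => c (Fin.last K) = β ∧
        (Finset.univ.filter fun i : Fin K => p i ∨ c i.castSucc ≠ c i.succ).card = m).card
      = if (Finset.univ.filter p).card ≤ m then
          A ^ (Finset.univ.filter p).card * (A - 1) ^ (m - (Finset.univ.filter p).card) *
            Nat.choose (K - (Finset.univ.filter p).card) (m - (Finset.univ.filter p).card)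
        else 0 := by
  have h := congrArg (fun f => coeff f m) (sum_coloring_weight β K p)
  have hc : (Finset.univ.filter fun i => ¬ p i).card = K - (Finset.univ.filter p).card := by
    have := Finset.card_filter_add_card_filter_not (s := (Finset.univ : Finset (Fin K))) p
    rw [Finset.card_univ, Fintype.card_fin] at this
    omega
  simp only [Finset.prod_ite, Finset.prod_const, hc, mul_pow,
    finsetSum_coeff] at h
  rw [← C_pow, mul_assoc, coeff_C_mul, coeff_X_pow_mul'] at h
  rw [Finset.card_filter]
  convert h using 1
  · refine Finset.sum_congr rfl fun c _ => ?_
    by_cases hb : c (Fin.last K) = β <;> simp [hb, coeff_X_pow, eq_comm]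
  · rw [coeff_one_add_C_mul_X_pow]
    split_ifs <;> ring

/-- For `n ≥ 1`, `α ≥ 1`, a color `β`, and `0 ≤ m ≤ n−1`: the number of
`α`-colored permutations of `[n]` with last color `β` and exactly `m` descents
equals `∑_{π ∈ S_n, d(π) ≤ m} α^{d(π)} (α−1)^{m−d(π)} C(n−1−d(π), m−d(π))`. -/
theorem stmt11 (n A m : ℕ) (hn : 1 ≤ n) (hA : 1 ≤ A) (β : Fin A)
    (hm : m ≤ n - 1) :
    ((coloredPerms n A β).filter fun τ => coloredDescents τ.1 τ.2 = m).card
      = ∑ π ∈ Finset.univ.filter (fun π : Equiv.Perm (Fin n) => descents π ≤ m),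
          A ^ descents π * (A - 1) ^ (m - descents π) *
            Nat.choose (n - 1 - descents π) (m - descents π) := by
  obtain ⟨K, rfl⟩ : ∃ K, n = K + 1 := ⟨n - 1, by omega⟩
  rw [coloredPerms, Finset.filter_filter, Finset.card_filter, Fintype.sum_prod_type,
    Finset.sum_filter]
  refine Finset.sum_congr rfl fun w _ => ?_
  rw [← Finset.card_filter]
  have hlast (c : Fin (K + 1) → Fin A) :
      (∀ h : K + 1 - 1 < K + 1, c ⟨K + 1 - 1, h⟩ = β) ↔ c (Fin.last K) = β :=
    ⟨fun h => h (Nat.lt_succ_self K), fun h _ => h⟩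
  simp only [hlast]
  exact card_coloring β K m fun i : Fin K => w i.succ < w i.castSucc
end

section
/- Fix integers n ≥ 1, α ≥ 1, and a color β ∈ {1,…,α}, and for m ≥ 0 let A^α(n,m) denote the number of α-colored permutations of [n] with last color β having exactly m descents. Then the sequence (A^α(n,m))_m is log-concave: for every m ≥ 1, A^α(n,m)^2 ≥ A^α(n,m−1) · A^α(n,m+1). -/
/-- The `α`-colored Eulerian number `A^α(n,m)`: the number of `α`-colored
permutations of `[n]` with last color `β` having exactly `m` descents. -/
def coloredEulerian (n A : ℕ) (β : Fin A) (m : ℕ) : ℕ :=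
  ((coloredPerms n A β).filter fun τ => coloredDescents τ.1 τ.2 = m).card

open Polynomial

/-- The product over consecutive pairs of a list of `p` for a descent and `q` for an ascent. -/
def descentWeight {R : Type*} [CommSemiring R] (p q : R) : List ℕ → R
  | a :: b :: l => (if b < a then p else q) * descentWeight p q (b :: l)
  | _ => 1

/-- `∑ X ^ des w * (1 + X) ^ asc w` over the permutations `w` of `N + 1` letters. -/
noncomputable def ascentDescentPoly (N : ℕ) : ℝ[X] :=
  ∑ w : Equiv.Perm (Fin (N + 1)), ∏ i : Fin N,
    if w i.succ < w i.castSucc then X else 1 + X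

lemma descentWeight_ofFn {R : Type*} [CommSemiring R] (p q : R) (N : ℕ) (f : Fin (N + 1) → ℕ) :
    descentWeight p q (List.ofFn f) = ∏ i : Fin N, if f i.succ < f i.castSucc then p else q := by
  induction N with
  | zero => simp [descentWeight]
  | succ N ih =>
    have h := ih (fun i => f i.succ)
    rw [List.ofFn_succ] at h
    rw [List.ofFn_succ, List.ofFn_succ, descentWeight, h, Fin.prod_univ_succ]
    rfl

lemma sum_descentWeight_insert_tail (a b : ℕ) (t : List ℕ) (hb : b < a) (ht : ∀ x ∈ t, x < a) :
    ((t.permutations'Aux a).map fun u => descentWeight (X : ℝ[X]) (1 + X) (b :: u)).sum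
      + X * descentWeight X (1 + X) (b :: t)
      = derivative (X * (1 + X) * descentWeight X (1 + X) (b :: t)) := by
  induction t generalizing b with
  | nil =>
    simp [descentWeight, hb.not_gt]
  | cons c t ih =>
    have hc : c < a := ht c (by simp)
    have h := ih c hc (fun x hx => ht x (by simp [hx]))
    simp only [List.permutations'Aux, List.map_cons, List.sum_cons, List.map_map,
      Function.comp_def, descentWeight, hb.not_gt, hc, if_true, if_false, List.sum_map_mul_left]
    split_ifs <;> simp only [derivative_mul, derivative_add, derivative_one, derivative_X] at h ⊢
    · linear_combination X * h
    · linear_combination (1 + X) * h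

lemma sum_descentWeight_insert (a : ℕ) (l : List ℕ) (hl : l ≠ []) (h : ∀ x ∈ l, x < a) :
    ((l.permutations'Aux a).map (descentWeight (X : ℝ[X]) (1 + X))).sum
      = derivative (X * (1 + X) * descentWeight X (1 + X) l) := by
  cases l with
  | nil => exact absurd rfl hl
  | cons b t =>
    have hb : b < a := h b (by simp)
    rw [← sum_descentWeight_insert_tail a b t hb (fun x hx => h x (by simp [hx]))]
    simp only [List.permutations'Aux, List.map_cons, List.sum_cons, List.map_map,
      Function.comp_def, descentWeight, hb, if_true]
    ring

lemma sum_perm_ofFn {M : Type*} [AddCommMonoid M] (n : ℕ) (g : List ℕ → M) :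
    ∑ w : Equiv.Perm (Fin n), g (List.ofFn fun i => (w i : ℕ))
      = (((List.range n).reverse.permutations').map g).sum := by
  classical
  have hnd : ((List.range n).reverse.permutations').Nodup :=
    (List.permutations_perm_permutations' _).nodup_iff.1
      (List.nodup_permutations _ (List.nodup_reverse.2 List.nodup_range))
  have hinj : Function.Injective
      fun w : Equiv.Perm (Fin n) => List.ofFn fun i => (w i : ℕ) := by
    intro v w h
    ext i
    exact congrFun (List.ofFn_injective h) i
  have himg : Finset.univ.image (fun w : Equiv.Perm (Fin n) => List.ofFn fun i => (w i : ℕ))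
      = ((List.range n).reverse.permutations').toFinset := by
    apply Finset.eq_of_subset_of_card_le
    · intro l hl
      obtain ⟨w, -, rfl⟩ := Finset.mem_image.1 hl
      rw [List.mem_toFinset, List.mem_permutations']
      refine (Equiv.Perm.ofFn_comp_perm w (fun i : Fin n => (i : ℕ))).trans ?_
      rw [show List.ofFn (fun i : Fin n => (i : ℕ)) = List.range n by
        apply List.ext_getElem <;> simp]
      exact (List.reverse_perm _).symm
    · rw [List.toFinset_card_of_nodup hnd, Finset.card_image_of_injective _ hinj,
        ← (List.permutations_perm_permutations' _).length_eq, List.length_permutations]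
      simp [Fintype.card_perm]
  rw [← List.sum_toFinset g hnd, ← himg, Finset.sum_image hinj.injOn]

lemma ascentDescentPoly_eq (N : ℕ) :
    ascentDescentPoly N = (((List.range (N + 1)).reverse.permutations').map
      (descentWeight (X : ℝ[X]) (1 + X))).sum := by
  rw [← sum_perm_ofFn]
  simp only [descentWeight_ofFn, Fin.val_fin_lt, ascentDescentPoly]

lemma ascentDescentPoly_succ (N : ℕ) :
    ascentDescentPoly (N + 1) = derivative (X * (1 + X) * ascentDescentPoly N) := by
  rw [ascentDescentPoly_eq, ascentDescentPoly_eq, List.range_succ, List.reverse_append]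
  simp only [List.reverse_singleton, List.singleton_append, List.permutations',
    List.map_flatMap]
  rw [List.flatMap_def, List.sum_flatten, List.map_map]
  rw [← List.sum_map_mul_left, map_list_sum, List.map_map]
  congr 1
  apply List.map_congr_left
  intro l hl
  rw [List.mem_permutations'] at hl
  refine sum_descentWeight_insert _ _ ?_ ?_
  · rintro rfl
    simpa using hl.length_eq
  · intro x hx
    simpa using hl.mem_iff.1 hx

lemma ascentDescentPoly_splits (N : ℕ) :
    (ascentDescentPoly N).Splits ∧ (ascentDescentPoly N).natDegree = N := by
  induction N with
  | zero =>
    have : ascentDescentPoly 0 = 1 := by simp [ascentDescentPoly]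
    simp [this]
  | succ N ih =>
    obtain ⟨hs, hd⟩ := ih
    rw [ascentDescentPoly_succ]
    set p := ascentDescentPoly N
    have hp : p ≠ 0 := by
      intro h0
      have : (ascentDescentPoly N).eval 1 = 0 := by simp [p] at h0; simp [h0]
      rw [ascentDescentPoly, eval_finsetSum] at this
      refine (Finset.sum_pos (fun w _ => ?_) Finset.univ_nonempty).ne' this
      rw [eval_prod]
      refine Finset.prod_pos fun i _ => ?_
      split_ifs <;> norm_num
    have hX1 : (1 + X : ℝ[X]) = X + C 1 := by rw [C_1, add_comm]
    have hq : (X * (1 + X) * p).Splits := by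
      rw [hX1]
      exact (Splits.X.mul (Splits.X_add_C 1)).mul hs
    have hqd : (X * (1 + X) * p).natDegree = N + 2 := by
      rw [hX1, natDegree_mul (mul_ne_zero X_ne_zero (X_add_C_ne_zero 1)) hp,
        natDegree_mul X_ne_zero (X_add_C_ne_zero 1), natDegree_X, natDegree_X_add_C, hd]
      ring
    have h1 := card_roots_le_derivative (X * (1 + X) * p)
    rw [← hq.natDegree_eq_card_roots, hqd] at h1
    have h2 := natDegree_derivative_le (X * (1 + X) * p)
    have h3 := card_roots' (derivative (X * (1 + X) * p))
    rw [splits_iff_card_roots]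
    omega

lemma ascentDescentPoly_root_mem (N : ℕ) (y : ℝ) (hy : (ascentDescentPoly N).eval y = 0) :
    -1 ≤ y ∧ y ≤ 0 := by
  have hev : (ascentDescentPoly N).eval y = ∑ w : Equiv.Perm (Fin (N + 1)), ∏ i : Fin N,
      if w i.succ < w i.castSucc then y else 1 + y := by
    simp [ascentDescentPoly, eval_finsetSum, eval_prod, apply_ite (eval y)]
  rw [hev] at hy
  constructor
  · by_contra! h
    refine (Finset.sum_pos (fun w _ => ?_) Finset.univ_nonempty).ne'
      (show ∑ w : Equiv.Perm (Fin (N + 1)), ∏ i : Fin N,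
        (-1) * (if w i.succ < w i.castSucc then y else 1 + y) = 0 by
        simp only [Finset.prod_mul_distrib, ← Finset.mul_sum, hy, mul_zero])
    refine Finset.prod_pos fun i _ => ?_
    split_ifs <;> linarith
  · by_contra! h
    refine (Finset.sum_pos (fun w _ => ?_) Finset.univ_nonempty).ne' hy
    refine Finset.prod_pos fun i _ => ?_
    split_ifs <;> linarith

/-- Nonnegative coefficients whose ratios of consecutive terms are (weakly) decreasing. -/
def Polynomial.IsPolyaTwo (p : ℝ[X]) : Prop :=
  (∀ i, 0 ≤ p.coeff i) ∧
    ∀ i j, i ≤ j → p.coeff i * p.coeff (j + 2) ≤ p.coeff (i + 1) * p.coeff (j + 1)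

lemma Polynomial.IsPolyaTwo.C_nonneg {c : ℝ} (hc : 0 ≤ c) : (C c).IsPolyaTwo := by
  refine ⟨fun i => ?_, fun i j _ => ?_⟩
  · rw [coeff_C]
    split_ifs <;> simp [hc]
  · simp [coeff_C]

lemma Polynomial.IsPolyaTwo.linear_mul {p : ℝ[X]} (hp : p.IsPolyaTwo) {a b : ℝ}
    (ha : 0 ≤ a) (hb : 0 ≤ b) : ((C b * X + C a) * p).IsPolyaTwo := by
  obtain ⟨h0, h1⟩ := hp
  have c0 : ((C b * X + C a) * p).coeff 0 = a * p.coeff 0 := by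
    simp [mul_coeff_zero]
  have cs (k : ℕ) : ((C b * X + C a) * p).coeff (k + 1) = b * p.coeff k + a * p.coeff (k + 1) := by
    rw [add_mul, coeff_add, mul_assoc, coeff_C_mul, coeff_X_mul, coeff_C_mul]
  refine ⟨fun i => ?_, fun i j hij => ?_⟩
  · cases i with
    | zero => rw [c0]; exact mul_nonneg ha (h0 0)
    | succ k =>
      rw [cs]
      exact add_nonneg (mul_nonneg hb (h0 _)) (mul_nonneg ha (h0 _))
  · cases i with
    | zero =>
      rw [c0, cs, cs, cs]
      have e1 := mul_le_mul_of_nonneg_left (h1 0 j hij) (mul_nonneg ha ha)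
      have e2 := mul_nonneg (mul_nonneg hb hb) (mul_nonneg (h0 0) (h0 j))
      have e3 := mul_nonneg (mul_nonneg ha hb) (mul_nonneg (h0 1) (h0 j))
      simp only [zero_add] at e1 ⊢
      linear_combination e1 + e2 + e3
    | succ k =>
      obtain ⟨j, rfl⟩ : ∃ j', j = j' + 1 := ⟨j - 1, by omega⟩
      have hkj : k ≤ j := by omega
      rw [cs, cs, cs, cs]
      have e1 := mul_le_mul_of_nonneg_left (h1 (k + 1) (j + 1) hij) (mul_nonneg ha ha)
      have e2 := mul_le_mul_of_nonneg_left (h1 k j hkj) (mul_nonneg hb hb)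
      have e3 : p.coeff k * p.coeff (j + 1 + 2) ≤ p.coeff (k + 1 + 1) * p.coeff (j + 1) := by
        refine (h1 k (j + 1) (by omega)).trans ?_
        rcases hkj.eq_or_lt with rfl | hlt
        · exact (mul_comm _ _).le
        · exact h1 (k + 1) j hlt
      have e4 := mul_le_mul_of_nonneg_left e3 (mul_nonneg ha hb)
      linear_combination e1 + e2 + e4

lemma Polynomial.IsPolyaTwo.C_mul_prod_linear {c α : ℝ} (hc : 0 ≤ c) (hα : 1 ≤ α)
    (s : Multiset ℝ) (hs : ∀ r ∈ s, -1 ≤ r ∧ r ≤ 0) :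
    (C c * (s.map fun r => C (α + r) * X + C (-r)).prod).IsPolyaTwo := by
  induction s using Multiset.induction_on with
  | empty => simpa using IsPolyaTwo.C_nonneg hc
  | cons r s ih =>
    rw [Multiset.map_cons, Multiset.prod_cons, mul_left_comm]
    have hr := hs r (Multiset.mem_cons_self r s)
    exact (ih fun x hx => hs x (Multiset.mem_cons_of_mem hx)).linear_mul
      (by linarith) (by linarith)

lemma isPolyaTwo_sum_perm (N : ℕ) {α : ℝ} (hα : 1 ≤ α) :
    (∑ w : Equiv.Perm (Fin (N + 1)), ∏ i : Fin N,
      if w i.succ < w i.castSucc then C α * X else 1 + C (α - 1) * X).IsPolyaTwo := by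
  obtain ⟨hs, hd⟩ := ascentDescentPoly_splits N
  have hcard := hs.natDegree_eq_card_roots
  set p := ascentDescentPoly N with hpdef
  have hev (y : ℝ) : p.eval y = ∑ w : Equiv.Perm (Fin (N + 1)), ∏ i : Fin N,
      if w i.succ < w i.castSucc then y else 1 + y := by
    simp [p, ascentDescentPoly, eval_finsetSum, eval_prod, apply_ite (eval y)]
  have hprod (y : ℝ) : p.eval y = p.leadingCoeff * (p.roots.map fun r => y - r).prod := by
    rw [hs.eval_eq_prod_roots]
  have hroots : ∀ r ∈ p.roots, -1 ≤ r ∧ r ≤ 0 := fun r hr =>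
    ascentDescentPoly_root_mem N r (isRoot_of_mem_roots hr)
  have hlc : 0 ≤ p.leadingCoeff := by
    have h1 : 0 ≤ p.eval 1 := by
      rw [hev]
      refine Finset.sum_nonneg fun w _ => Finset.prod_nonneg fun i _ => ?_
      split_ifs <;> norm_num
    have h2 : 0 < (p.roots.map fun r => 1 - r).prod := by
      apply Multiset.prod_pos
      intro a ha
      obtain ⟨r, hr, rfl⟩ := Multiset.mem_map.1 ha
      linarith [(hroots r hr).2]
    rw [hprod] at h1
    exact nonneg_of_mul_nonneg_left h1 h2
  have key : (∑ w : Equiv.Perm (Fin (N + 1)), ∏ i : Fin N,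
      if w i.succ < w i.castSucc then C α * X else 1 + C (α - 1) * X)
      = C p.leadingCoeff * (p.roots.map fun r => C (α + r) * X + C (-r)).prod := by
    apply eq_of_infinite_eval_eq
    refine (Set.Iio_infinite (1 : ℝ)).mono fun x hx => ?_
    have hx0 : 1 - x ≠ 0 := by
      have : x < 1 := hx
      linarith
    have hy : (1 - x) * (α * x / (1 - x)) = α * x := by field_simp
    set y := α * x / (1 - x)
    have hl : eval x (∑ w : Equiv.Perm (Fin (N + 1)), ∏ i : Fin N,
        if w i.succ < w i.castSucc then C α * X else 1 + C (α - 1) * X)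
        = (1 - x) ^ N * p.eval y := by
      rw [hev, eval_finsetSum, Finset.mul_sum]
      refine Finset.sum_congr rfl fun w _ => ?_
      rw [eval_prod, show (1 - x) ^ N = ∏ _i : Fin N, (1 - x) by simp, ← Finset.prod_mul_distrib]
      refine Finset.prod_congr rfl fun i _ => ?_
      split_ifs
      · simp [hy]
      · simp only [eval_add, eval_one, eval_mul, eval_C, eval_X]
        linear_combination -hy
    have hr : eval x (C p.leadingCoeff * (p.roots.map fun r => C (α + r) * X + C (-r)).prod)
        = (1 - x) ^ N * p.eval y := by
      have hfac : ∀ r : ℝ, eval x (C (α + r) * X + C (-r)) = (1 - x) * (y - r) := by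
        intro r
        simp only [eval_add, eval_mul, eval_C, eval_X]
        linear_combination -hy
      rw [hprod, eval_mul, eval_C, eval_multiset_prod, Multiset.map_map]
      simp only [Function.comp_def, hfac, Multiset.prod_map_mul, Multiset.map_const',
        Multiset.prod_replicate, ← hcard, hd]
      ring
    exact hl.trans hr.symm
  rw [key]
  exact IsPolyaTwo.C_mul_prod_linear hlc hα _ hroots

lemma sum_colorings_eq_prod (A N : ℕ) (β : Fin A) (D : Fin N → Prop) [DecidablePred D] :
    (∑ c : Fin (N + 1) → Fin A, if c (Fin.last N) = β then
      ∏ i : Fin N, (if D i ∨ c i.castSucc ≠ c i.succ then (X : ℝ[X]) else 1) else 0)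
      = ∏ i : Fin N, if D i then C (A : ℝ) * X else 1 + C ((A : ℝ) - 1) * X := by
  induction N with
  | zero =>
    rw [← (Equiv.funUnique (Fin 1) (Fin A)).symm.sum_comp]
    simp
  | succ N ih =>
    rw [← (Fin.consEquiv fun _ => Fin A).sum_comp, Fintype.sum_prod_type_right,
      Fin.prod_univ_succ, ← ih (fun i => D i.succ), Finset.mul_sum]
    refine Finset.sum_congr rfl fun c _ => ?_
    have hlast (a : Fin A) : (Fin.consEquiv fun _ => Fin A) (a, c) (Fin.last (N + 1))
        = c (Fin.last N) := by
      rw [← Fin.succ_last]; rfl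
    have hhead : (∑ a : Fin A, if D 0 ∨ a ≠ c 0 then (X : ℝ[X]) else 1)
        = if D 0 then C (A : ℝ) * X else 1 + C ((A : ℝ) - 1) * X := by
      by_cases hD : D 0
      · simp [hD]
      · have (a : Fin A) : (if D 0 ∨ a ≠ c 0 then (X : ℝ[X]) else 1)
            = X + if a = c 0 then 1 - X else 0 := by
          by_cases h : a = c 0 <;> simp [hD, h]
        rw [Finset.sum_congr rfl fun a _ => this a]
        simp [Finset.sum_add_distrib, hD]
        ring
    simp only [hlast]
    by_cases h : c (Fin.last N) = β
    · simp only [h, if_true]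
      rw [← hhead, Finset.sum_mul]
      refine Finset.sum_congr rfl fun a _ => ?_
      rw [Fin.prod_univ_succ]
      rfl
    · simp [h]

lemma coloredEulerian_eq_coeff (N A : ℕ) (β : Fin A) (m : ℕ) :
    (coloredEulerian (N + 1) A β m : ℝ) = (∑ w : Equiv.Perm (Fin (N + 1)), ∏ i : Fin N,
      if w i.succ < w i.castSucc then C (A : ℝ) * X else 1 + C ((A : ℝ) - 1) * X).coeff m := by
  have hdes (w : Equiv.Perm (Fin (N + 1))) (c : Fin (N + 1) → Fin A) :
      ∏ i : Fin N, (if w i.succ < w i.castSucc ∨ c i.castSucc ≠ c i.succ then (X : ℝ[X]) else 1)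
        = X ^ coloredDescents w c := by
    rw [Finset.prod_ite, Finset.prod_const, Finset.prod_const_one, mul_one]
    rfl
  simp only [← sum_colorings_eq_prod A N β, hdes]
  rw [← Fintype.sum_prod_type' (f := fun (w : Equiv.Perm (Fin (N + 1)))
    (c : Fin (N + 1) → Fin A) => if c (Fin.last N) = β then (X : ℝ[X]) ^ coloredDescents w c else 0)]
  have hfilter : (Finset.univ.filter fun τ : Equiv.Perm (Fin (N + 1)) × (Fin (N + 1) → Fin A) =>
      τ.2 (Fin.last N) = β) = coloredPerms (N + 1) A β := by
    ext τ
    simp only [coloredPerms, Finset.mem_filter, Finset.mem_univ, true_and]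
    exact ⟨fun h _ => h, fun h => h (by omega)⟩
  rw [← Finset.sum_filter, hfilter, finsetSum_coeff, coloredEulerian, Finset.card_filter,
    Nat.cast_sum]
  refine Finset.sum_congr rfl fun τ _ => ?_
  rw [coeff_X_pow]
  simp [eq_comm]

/-- For `n ≥ 1`, `α ≥ 1`, and a color `β`, the `α`-colored Eulerian numbers
are log-concave: `A^α(n,m)² ≥ A^α(n,m−1)·A^α(n,m+1)` for all `m ≥ 1`. -/
theorem stmt13 (n A : ℕ) (hn : 1 ≤ n) (hA : 1 ≤ A) (β : Fin A)
    (m : ℕ) (hm : 1 ≤ m) :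
    coloredEulerian n A β (m - 1) * coloredEulerian n A β (m + 1)
      ≤ coloredEulerian n A β m ^ 2 := by
  obtain ⟨N, rfl⟩ : ∃ N, n = N + 1 := ⟨n - 1, by omega⟩
  obtain ⟨k, rfl⟩ : ∃ k, m = k + 1 := ⟨m - 1, by omega⟩
  have h := (isPolyaTwo_sum_perm N (α := (A : ℝ)) (by exact_mod_cast hA)).2 k k le_rfl
  simp only [← coloredEulerian_eq_coeff N A β] at h
  rw [Nat.add_sub_cancel, sq]
  exact_mod_cast h
end
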